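/- Let n ≥ 3, let x_1,…,x_n be indeterminates over ℚ, let f(T) = ∏_{j=1}^n (T − x_j), and let i_1,…,i_{n−1} ∈ {1,…,n} be pairwise distinct indices, with j the unique index in {1,…,n} ∖ {i_1,…,i_{n−1}}. Let J be the ideal of ℚ[x_1,…,x_n] generated by H_1(f)(x_{i_1}), H_2(f)(x_{i_2}), …, H_{n−1}(f)(x_{i_{n−1}}). Fix the graded lexicographic monomial order determined by the variable ordering x_{i_{n−1}} > x_{i_{n−2}} > ⋯ > x_{i_1} > x_j. Then for each k = 1,…,n−1 there exists an integer m_k ≥ 1 and a nonzero polynomial g ∈ J whose leading monomial is x_{i_k}^{m_k}. -/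

import Mathlib

open Polynomial MvPolynomial

/-- Total degree of an exponent vector. -/
def expDegree {n : ℕ} (α : Fin n →₀ ℕ) : ℕ := α.sum fun _ e => e

/-- The graded lexicographic strict order on exponent vectors relative to a ranking `ρ` of
the variables: `ρ v` is the rank of the variable `x_v`, and rank `0` is the *biggest*
variable. Ties in total degree are broken lexicographically along increasing rank. -/
def GrlexLT {n : ℕ} (ρ : Fin n → Fin n) (α β : Fin n →₀ ℕ) : Prop :=
  expDegree α < expDegree β ∨
    (expDegree α = expDegree β ∧
      ∃ v : Fin n, (∀ w : Fin n, ρ w < ρ v → α w = β w) ∧ α v < β v)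

/-- `m` is the leading monomial of the polynomial `g` w.r.t. the graded lex order given by
the ranking `ρ`: it occurs in `g` and dominates every other monomial of `g`. -/
def IsLeadingMonomial {n : ℕ} {R : Type*} [CommSemiring R] (ρ : Fin n → Fin n)
    (g : MvPolynomial (Fin n) R) (m : Fin n →₀ ℕ) : Prop :=
  m ∈ g.support ∧ ∀ m' ∈ g.support, m' = m ∨ GrlexLT ρ m' m

namespace Polynomial

/-- A form of the Gauss–Lucas theorem for iterated derivatives. -/
theorem mem_of_eval_iterate_derivative_eq_zero {S : Set ℂ} (hS : Convex ℝ S) {i : ℕ}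
    {P : ℂ[X]} (hP : i < P.natDegree) (hroots : ∀ z, P.eval z = 0 → z ∈ S) {z : ℂ}
    (hz : (derivative^[i] P).eval z = 0) : z ∈ S := by
  induction i generalizing P z with
  | zero => exact hroots z hz
  | succ i ih =>
    refine ih (by rw [natDegree_derivative]; omega) (fun w hw => ?_) hz
    have hdeg : 0 < P.degree := natDegree_pos_iff_degree_pos.mp (by omega)
    have hP' : derivative P ≠ 0 := by
      intro h
      have := natDegree_derivative (p := P)
      rw [h, natDegree_zero] at this
      omega
    refine convexHull_min (fun u hu => hroots u ?_) hS
      (rootSet_derivative_subset_convexHull_rootSet hdeg ?_)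
    · simpa using (mem_rootSet.mp hu).2
    · exact mem_rootSet.mpr ⟨hP', by simpa using hw⟩

/-- If the roots of `P` lie in a convex set, then a root of the `i`-th derivative of `P` that is
an extreme point of this set is a root of `P` of multiplicity greater than `i`. -/
theorem lt_rootMultiplicity_of_mem_extremePoints {K : Set ℂ} (hK : Convex ℝ K) {v : ℂ}
    (hv : v ∈ K.extremePoints ℝ) {i : ℕ} {P : ℂ[X]} (hP : i < P.natDegree)
    (hroots : ∀ z, P.eval z = 0 → z ∈ K) (hz : (derivative^[i] P).eval v = 0) :
    i < P.rootMultiplicity v := by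
  induction i generalizing P with
  | zero =>
    exact (rootMultiplicity_pos (by rintro rfl; simp at hP)).mpr hz
  | succ i ih =>
    by_cases h : P.eval v = 0
    · have := ih (P := derivative P) (by rw [natDegree_derivative]; omega)
        (fun z hz => mem_of_eval_iterate_derivative_eq_zero (i := 1) hK (by omega) hroots hz) hz
      rw [derivative_rootMultiplicity_of_root h] at this
      omega
    · have hmem := mem_of_eval_iterate_derivative_eq_zero
        (hK.mem_extremePoints_iff_convex_sdiff.mp hv).2 hP
        (fun w hw => ⟨hroots w hw, fun hwv => h (hwv ▸ hw)⟩) hz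
      exact absurd rfl hmem.2

end Polynomial

/-- A compact convex set all of whose extreme points equal `a` is contained in `{a}`. -/
theorem IsCompact.eq_of_forall_extremePoints_eq {K : Set ℂ} (hK : IsCompact K)
    (hconv : Convex ℝ K) {a : ℂ} (h : ∀ v ∈ K.extremePoints ℝ, v = a) {z : ℂ} (hz : z ∈ K) :
    z = a := by
  rw [← closure_convexHull_extremePoints hK hconv] at hz
  exact closure_minimal (convexHull_min (t := {a}) h (convex_singleton a)) isClosed_singleton hz

theorem Fin.exists_eq_of_injective_of_notMem_range {n : ℕ} {i : Fin (n - 1) → Fin n}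
    (hi : Function.Injective i) {j : Fin n} (hj : j ∉ Set.range i) {l : Fin n} (hl : l ≠ j) :
    ∃ k, i k = l := by
  have himage : Finset.univ.image i = Finset.univ.erase j := by
    refine Finset.eq_of_subset_of_card_le (fun a ha => ?_) ?_
    · obtain ⟨k, -, rfl⟩ := Finset.mem_image.mp ha
      exact Finset.mem_erase.mpr ⟨fun h => hj ⟨k, h⟩, Finset.mem_univ _⟩
    · simp [Finset.card_image_of_injective _ hi]
  have hmem : l ∈ Finset.univ.image i := by
    rw [himage]
    exact Finset.mem_erase.mpr ⟨hl, Finset.mem_univ _⟩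
  simpa using hmem

/-- If all roots of a complex polynomial but one (listed with multiplicity) are bijectively
matched with the derivatives of orders `1, …, n - 1` vanishing there, then all roots agree. -/
theorem eq_of_iterate_derivative_eval_eq_zero {n : ℕ} {x : Fin n → ℂ} {i : Fin (n - 1) → Fin n}
    (hi : Function.Injective i) {j : Fin n} (hj : j ∉ Set.range i)
    (h : ∀ k : Fin (n - 1), (derivative^[k.val + 1]
      (∏ l, (Polynomial.X - Polynomial.C (x l)))).eval (x (i k)) = 0) (l : Fin n) :
    x l = x j := by
  set P : ℂ[X] := ∏ l, (Polynomial.X - Polynomial.C (x l)) with hP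
  have hroots : P.roots = Finset.univ.val.map x := by
    rw [hP, ← roots_multiset_prod_X_sub_C (Finset.univ.val.map x), Multiset.map_map]
    rfl
  have hmonic : P.Monic := monic_prod_of_monic _ _ fun l _ => monic_X_sub_C _
  have hdeg : P.natDegree = n := by
    rw [hP, natDegree_prod_of_monic _ _ fun l _ => monic_X_sub_C _]
    simp
  have hK : IsCompact (convexHull ℝ (Set.range x)) := (Set.finite_range x).isCompact_convexHull ℝ
  have hconv := convex_convexHull ℝ (Set.range x)
  refine hK.eq_of_forall_extremePoints_eq hconv (fun v hv => ?_) (subset_convexHull _ _ ⟨l, rfl⟩)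
  by_contra hvj
  set A : Finset (Fin (n - 1)) := {k | x (i k) = v} with hA
  have hmult : P.rootMultiplicity v = A.card := by
    rw [← count_roots, hroots, Multiset.count_map, ← Finset.card_image_of_injective A hi]
    change (Finset.univ.filter fun a => v = x a).card = _
    congr 1
    ext a
    simp only [hA, Finset.mem_filter, Finset.mem_univ, true_and, Finset.mem_image]
    constructor
    · rintro rfl
      obtain ⟨k, rfl⟩ := Fin.exists_eq_of_injective_of_notMem_range hi hj
        (l := a) (by rintro rfl; exact hvj rfl)
      exact ⟨k, rfl, rfl⟩
    · rintro ⟨k, hk, rfl⟩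
      exact hk.symm
  have hpos : 0 < P.rootMultiplicity v := by
    obtain ⟨a, rfl⟩ := extremePoints_convexHull_subset hv
    rw [← count_roots, hroots]
    exact Multiset.count_pos.mpr (Multiset.mem_map_of_mem x (Finset.mem_univ a))
  have hlt : ∀ k ∈ A, k.val + 1 < A.card := by
    intro k hk
    rw [← hmult]
    refine lt_rootMultiplicity_of_mem_extremePoints hconv hv (by omega) (fun z hz => ?_) ?_
    · have hz' : z ∈ P.roots := (mem_roots hmonic.ne_zero).mpr hz
      rw [hroots] at hz'
      obtain ⟨a, -, rfl⟩ := Multiset.mem_map.mp hz'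
      exact subset_convexHull _ _ ⟨a, rfl⟩
    · rw [← (Finset.mem_filter.mp hk).2]
      exact h k
  have hcard : A.card ≤ (Finset.range (A.card - 1)).card :=
    Finset.card_le_card_of_injOn Fin.val
      (fun k hk => by have := hlt k hk; simp; omega) Fin.val_injective.injOn
  rw [Finset.card_range] at hcard
  omega

/-- The leading monomial of `(x_a - x_b) ^ N` is `x_a ^ N` when `x_a` is bigger than `x_b`. -/
theorem isLeadingMonomial_X_sub_X_pow {n : ℕ} {R : Type*} [CommRing R] [Nontrivial R]
    {ρ : Fin n → Fin n} {a b : Fin n} (hab : ρ a < ρ b) (N : ℕ) :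
    IsLeadingMonomial ρ ((MvPolynomial.X a - MvPolynomial.X b : MvPolynomial (Fin n) R) ^ N)
      (Finsupp.single a N) := by
  classical
  set g : MvPolynomial (Fin n) R := (MvPolynomial.X a - MvPolynomial.X b) ^ N with hg
  have hne : b ≠ a := by rintro rfl; exact lt_irrefl _ hab
  have hhom : g.IsHomogeneous N := by
    simpa using ((isHomogeneous_X R a).sub (isHomogeneous_X R b)).pow N
  have hvars : ∀ m ∈ g.support, ∀ w, w ≠ a → w ≠ b → m w = 0 := by
    intro m hm w hwa hwb
    by_contra hw
    have hmem : w ∈ g.vars := (mem_vars_iff_mem_support w).mpr ⟨m, hm, Finsupp.mem_support_iff.mpr hw⟩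
    have hmem' := vars_sub_subset (MvPolynomial.X a) (q := MvPolynomial.X b) (vars_pow _ _ hmem)
    rw [vars_X, vars_X, Finset.mem_union, Finset.mem_singleton, Finset.mem_singleton] at hmem'
    exact hmem'.elim hwa hwb
  have hsum : ∀ m ∈ g.support, m.degree = N := fun m hm => by
    rw [Finsupp.degree_eq_weight_one]
    exact hhom (mem_support_iff.mp hm)
  have hdegree : ∀ m ∈ g.support, m a + m b = N := by
    intro m hm
    have h1 := hsum m hm
    rw [Finsupp.degree_eq_sum,
      ← Finset.sum_subset (Finset.subset_univ {a, b}), Finset.sum_pair hne.symm] at h1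
    · exact h1
    · intro w _ hw
      simp only [Finset.mem_insert, Finset.mem_singleton, not_or] at hw
      exact hvars m hm w hw.1 hw.2
  have heq : ∀ m ∈ g.support, m b = 0 → m = Finsupp.single a N := by
    intro m hm hmb
    ext w
    have := hdegree m hm
    by_cases hwa : w = a
    · subst hwa
      simp
      omega
    · rw [Finsupp.single_eq_of_ne hwa]
      by_cases hwb : w = b
      · rw [hwb, hmb]
      · exact hvars m hm w hwa hwb
  refine ⟨?_, fun m hm => ?_⟩
  · by_contra hmem
    have heval : MvPolynomial.eval (Pi.single a (1 : R)) g = 1 := by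
      simp [hg, hne]
    rw [MvPolynomial.eval_eq, Finset.sum_eq_zero] at heval
    · exact zero_ne_one heval
    · intro m hm
      have hmb : m b ≠ 0 := fun h => hmem (heq m hm h ▸ hm)
      rw [Finset.prod_eq_zero (i := b) (Finsupp.mem_support_iff.mpr hmb), mul_zero]
      simp [hne, hmb]
  · by_cases hmb : m b = 0
    · exact Or.inl (heq m hm hmb)
    · have hd := hdegree m hm
      refine Or.inr (Or.inr ⟨?_, a, fun w hw => ?_, ?_⟩)
      · rw [expDegree, expDegree, Finsupp.sum_single_index rfl]
        exact hsum m hm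
      · have hwa : w ≠ a := by rintro rfl; exact lt_irrefl _ hw
        have hwb : w ≠ b := by rintro rfl; exact lt_asymm hw hab
        rw [hvars m hm w hwa hwb, Finsupp.single_eq_of_ne hwa]
      · simp
        omega

/-- For `n ≥ 3`, pairwise distinct indices `i₁,…,i_{n-1}` with unique
missing index `j`, and the ideal `J` generated by `H_k(f)(x_{i_k})` for `k = 1,…,n-1`, with
respect to the graded lex order for the variable ordering
`x_{i_{n-1}} > ⋯ > x_{i_1} > x_j`, for each `k = 1,…,n-1` there is `m_k ≥ 1` and a nonzero
`g ∈ J` with leading monomial `x_{i_k}^{m_k}`. -/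
theorem leading_powers_distinct_branch (n : ℕ) (hn : 3 ≤ n)
    (f : Polynomial (MvPolynomial (Fin n) ℚ))
    (hf : f = ∏ l : Fin n, (Polynomial.X - Polynomial.C (MvPolynomial.X l)))
    (i : Fin (n - 1) → Fin n) (hi : Function.Injective i)
    (j : Fin n) (hj : j ∉ Set.range i)
    (J : Ideal (MvPolynomial (Fin n) ℚ))
    (hJ : J = Ideal.span (Set.range fun k : Fin (n - 1) =>
      Polynomial.eval (MvPolynomial.X (i k)) (Polynomial.hasseDeriv (k.val + 1) f)))
    (ρ : Fin n → Fin n)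
    (hρi : ∀ k : Fin (n - 1), (ρ (i k)).val = n - 2 - k.val)
    (hρj : (ρ j).val = n - 1) :
    ∀ k : Fin (n - 1), ∃ m : ℕ, 1 ≤ m ∧
      ∃ g ∈ J, g ≠ 0 ∧ IsLeadingMonomial ρ g (Finsupp.single (i k) m) := by
  intro k
  have hrad : (MvPolynomial.X (i k) - MvPolynomial.X j : MvPolynomial (Fin n) ℚ) ∈ J.radical := by
    rw [← vanishingIdeal_zeroLocus_eq_radical (K := ℂ), mem_vanishingIdeal_iff]
    intro x hx
    have hroot : ∀ k : Fin (n - 1), (derivative^[k.val + 1]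
        (∏ l, (Polynomial.X - Polynomial.C (x l)))).eval (x (i k)) = 0 := by
      intro k
      have hgen : (MvPolynomial.aeval (R := ℚ) x).toRingHom (Polynomial.eval (MvPolynomial.X (i k))
          (Polynomial.hasseDeriv (k.val + 1) f)) = 0 :=
        hx _ (by rw [hJ]; exact Ideal.subset_span ⟨k, rfl⟩)
      have hmap : f.map (MvPolynomial.aeval (R := ℚ) x).toRingHom =
          ∏ l, (Polynomial.X - Polynomial.C (x l)) := by
        simp [hf, Polynomial.map_prod]
      rw [← hmap, Polynomial.iterate_derivative_map, ← factorial_smul_hasseDeriv]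
      have hXk : x (i k) = (MvPolynomial.aeval (R := ℚ) x).toRingHom (MvPolynomial.X (i k)) := by simp
      rw [hXk, Polynomial.eval_map_apply]
      rw [LinearMap.smul_apply, Polynomial.eval_smul, map_nsmul, hgen, smul_zero]
    have := eq_of_iterate_derivative_eval_eq_zero hi hj hroot (i k)
    simp [this]
  obtain ⟨N, hN⟩ := hrad
  have hlt : ρ (i k) < ρ j := by
    have := hρi k
    rw [Fin.lt_def]
    omega
  have hlead := isLeadingMonomial_X_sub_X_pow (R := ℚ) hlt (N + 1)
  refine ⟨N + 1, by omega, _, ?_, ?_, hlead⟩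
  · rw [pow_succ]
    exact J.mul_mem_right _ hN
  · intro h
    have := hlead.1
    rw [h] at this
    simp at this
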